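/- arXiv:1411.0234 — 2 statements merged into one kernel-verified Lean document; each statement's English description precedes it below -/
import Mathlib

section
/- Faà di Bruno's formula: let f, g : ℝ → ℝ be k-times continuously differentiable (k ≥ 1). Then the k-th derivative of the composite function satisfies (f∘g)^{(k)}(x) = Σ_{m ∈ S_k} c_k(m) · f^{(l_k)}(g(x)) · ∏_{i=1}^{k} (g^{(i)}(x))^{m_i}, where S_k = { m = (m_1,…,m_k) : m_j nonnegative integers with Σ_{j=1}^{k} j·m_j = k }, l_k = Σ_{j=1}^{k} m_j, and c_k(m) = k! / ∏_{j=1}^{k} ( m_j! · (j!)^{m_j} ). -/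
open Finset

namespace Multiset

/-- The order of the group of permutations of `Fin s.sum` preserving a set partition whose part
sizes, all positive, are given by `s`. -/
def partitionSymmetry (s : Multiset ℕ) : ℕ :=
  (s.map Nat.factorial).prod * ∏ a ∈ s.toFinset, (s.count a).factorial

lemma prod_factorial_count_eq {s : Multiset ℕ} {t : Finset ℕ} (h : s.toFinset ⊆ t) :
    ∏ a ∈ s.toFinset, (s.count a).factorial = ∏ a ∈ t, (s.count a).factorial :=
  Finset.prod_subset h fun a _ ha ↦ by
    rw [count_eq_zero_of_notMem (by simpa using ha), Nat.factorial_zero]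

lemma partitionSymmetry_cons (a : ℕ) (s : Multiset ℕ) :
    (a ::ₘ s).partitionSymmetry =
      a.factorial * (a ::ₘ s).count a * s.partitionSymmetry := by
  have h : s.toFinset ⊆ (a ::ₘ s).toFinset := by simp [Finset.subset_insert]
  have ha : a ∈ (a ::ₘ s).toFinset := by simp
  rw [partitionSymmetry, partitionSymmetry, prod_factorial_count_eq h,
    ← Finset.mul_prod_erase _ _ ha, ← Finset.mul_prod_erase _ (fun b ↦ (s.count b).factorial) ha,
    Finset.prod_congr rfl fun b hb ↦ by rw [count_cons_of_ne (Finset.ne_of_mem_erase hb)],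
    map_cons, prod_cons, count_cons_self, Nat.factorial_succ]
  ring

end Multiset

namespace OrderedFinpartition

variable {n : ℕ}

/-- The multiset of sizes of the parts of an ordered finpartition. -/
def partSizes (c : OrderedFinpartition n) : Multiset ℕ :=
  univ.val.map c.partSize

lemma partSizes_extend_none (c : OrderedFinpartition n) :
    (c.extend none).partSizes = 1 ::ₘ c.partSizes := by
  change (univ : Finset (Fin (c.length + 1))).val.map (Fin.cons 1 c.partSize) = _
  simp [partSizes, Fin.univ_succ, Function.comp_def]

lemma partSizes_extend_some (c : OrderedFinpartition n) (i : Fin c.length) :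
    (c.extend (some i)).partSizes = (c.partSize i + 1) ::ₘ c.partSizes.erase (c.partSize i) := by
  change (univ : Finset (Fin c.length)).val.map
    (Function.update c.partSize i (c.partSize i + 1)) = _
  have h : (univ : Finset (Fin c.length)).val = i ::ₘ (univ.erase i).val := by
    simp [Finset.erase_val, Multiset.cons_erase]
  rw [partSizes, h, Multiset.map_cons, Multiset.map_cons, Multiset.erase_cons_head,
    Function.update_self]
  congr 1
  exact Multiset.map_congr rfl fun j hj ↦
    Function.update_of_ne (Finset.ne_of_mem_erase (Finset.mem_def.2 hj)) _ _

lemma zero_notMem_partSizes (c : OrderedFinpartition n) : 0 ∉ c.partSizes := by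
  simp [partSizes, (c.partSize_pos _).ne']

lemma sum_partSizes (c : OrderedFinpartition n) : c.partSizes.sum = n := by
  have h := Fintype.card_congr c.equivSigma
  rw [Fintype.card_sigma, Fintype.card_fin] at h
  simp only [Fintype.card_fin] at h
  exact h

lemma count_partSizes (c : OrderedFinpartition n) (a : ℕ) :
    c.partSizes.count a = ∑ i, if c.partSize i = a then 1 else 0 := by
  rw [partSizes, Multiset.count_map, Finset.sum_boole, Nat.cast_id, Finset.card_def,
    Finset.filter_val]
  simp only [eq_comm]

/-- The number of ordered finpartitions with prescribed part sizes. -/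
noncomputable def numPartSizes (n : ℕ) (s : Multiset ℕ) : ℕ :=
  #{c : OrderedFinpartition n | c.partSizes = s}

lemma numPartSizes_succ (s : Multiset ℕ) (hs : 0 ∉ s) :
    numPartSizes (n + 1) s = ∑ b ∈ s.toFinset,
      if b = 1 then numPartSizes n (s.erase 1)
      else ((b - 1) ::ₘ s.erase b).count (b - 1) * numPartSizes n ((b - 1) ::ₘ s.erase b) := by
  have key (c : OrderedFinpartition n) :
      (∑ o, if (c.extend o).partSizes = s then 1 else 0) = ∑ b ∈ s.toFinset,
        if b = 1 then (if c.partSizes = s.erase 1 then 1 else 0)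
        else ((b - 1) ::ₘ s.erase b).count (b - 1) *
          (if c.partSizes = (b - 1) ::ₘ s.erase b then 1 else 0) := by
    have hleft : (if (c.extend none).partSizes = s then 1 else 0) = ∑ b ∈ s.toFinset,
        if b = 1 then (if c.partSizes = s.erase 1 then 1 else 0) else 0 := by
      rw [partSizes_extend_none, Finset.sum_ite_eq', ← ite_and]
      refine if_congr ⟨?_, ?_⟩ rfl rfl
      · rintro rfl
        simp
      · rintro ⟨h, h'⟩
        rw [h', Multiset.cons_erase (by simpa using h)]
    have hmid (i : Fin c.length) : (if (c.extend (some i)).partSizes = s then 1 else 0) =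
        ∑ b ∈ s.toFinset, if b = 1 then 0 else
          (if c.partSize i = b - 1 then 1 else 0) *
            (if c.partSizes = (b - 1) ::ₘ s.erase b then 1 else 0) := by
      have hi := c.partSize_pos i
      have hmem : c.partSize i ∈ c.partSizes := by simp [partSizes]
      rw [partSizes_extend_some]
      split_ifs with h
      · rw [Finset.sum_eq_single (c.partSize i + 1)]
        · simp [← h, hi.ne', Multiset.cons_erase hmem]
        · intro b hb hne
          have : b ≠ 0 := by rintro rfl; exact hs (by simpa using hb)
          rw [if_neg (show ¬ c.partSize i = b - 1 by omega)]
          simp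
        · intro h'
          exact absurd (by simp [← h]) h'
      · symm
        refine Finset.sum_eq_zero fun b hb ↦ ?_
        have hb' : b ∈ s := by simpa using hb
        have : b ≠ 0 := by rintro rfl; exact hs hb'
        by_cases h1 : c.partSize i = b - 1
        · have : b = c.partSize i + 1 := by omega
          rw [if_neg (show ¬ c.partSizes = (b - 1) ::ₘ s.erase b from fun h2 ↦ h ?_)]
          · simp
          · rw [h2, h1, Multiset.erase_cons_head, ← h1, ← this, Multiset.cons_erase hb']
        · simp [h1]
    simp only [Fintype.sum_option, hleft, hmid]
    rw [Finset.sum_comm, ← Finset.sum_add_distrib]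
    refine Finset.sum_congr rfl fun b _ ↦ ?_
    split_ifs with h1 h2 h2
    · simp
    · simp
    · simp [← h2, count_partSizes]
    · simp
  simp only [numPartSizes, Finset.card_filter]
  rw [← (extendEquiv n).sum_comp, Fintype.sum_sigma]
  simp only [extendEquiv_apply, key]
  rw [Finset.sum_comm]
  refine Finset.sum_congr rfl fun b _ ↦ ?_
  split_ifs
  · rfl
  · rw [Finset.mul_sum]

/-- The number of set partitions with prescribed part sizes. -/
theorem numPartSizes_mul_partitionSymmetry (s : Multiset ℕ) (hs : 0 ∉ s) (hn : s.sum = n) :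
    numPartSizes n s * s.partitionSymmetry = n.factorial := by
  induction n generalizing s with
  | zero =>
    have eq_zero {t : Multiset ℕ} (ht : 0 ∉ t) (h : t.sum = 0) : t = 0 :=
      Multiset.eq_zero_of_forall_notMem fun a ha ↦ ht <| by
        rwa [Multiset.sum_eq_zero_iff.1 h a ha] at ha
    have h0 (c : OrderedFinpartition 0) : c.partSizes = 0 :=
      eq_zero c.zero_notMem_partSizes c.sum_partSizes
    rw [eq_zero hs hn]
    simp [numPartSizes, Multiset.partitionSymmetry, h0]
  | succ n ih =>
    have hsum : ∑ b ∈ s.toFinset, s.count b * b = n + 1 := by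
      rw [← hn, Finset.sum_multiset_count]
      simp
    rw [numPartSizes_succ s hs, Finset.sum_mul, Nat.factorial_succ, ← hsum, Finset.sum_mul]
    refine Finset.sum_congr rfl fun b hb ↦ ?_
    obtain ⟨r, rfl⟩ := Multiset.exists_cons_of_mem (Multiset.mem_toFinset.1 hb)
    rw [Multiset.sum_cons] at hn
    rw [Multiset.mem_cons, not_or] at hs
    rw [Multiset.partitionSymmetry_cons, Multiset.erase_cons_head]
    split_ifs with h1
    · subst h1
      rw [← ih r hs.2 (by omega), Multiset.erase_cons_head, Nat.factorial_one]
      ring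
    · obtain ⟨a, rfl⟩ : ∃ a, b = a + 1 := ⟨b - 1, by omega⟩
      rw [Nat.add_sub_cancel, ← ih (a ::ₘ r) (by simp [hs.2]; omega) (by simp; omega),
        Multiset.partitionSymmetry_cons, Nat.factorial_succ]
      ring

end OrderedFinpartition

namespace Multiset

/-- The multiset in which `i + 1` has multiplicity `m i`, for `i : Fin k`. -/
def ofSuccCounts {k : ℕ} (m : Fin k → ℕ) : Multiset ℕ :=
  ∑ i, replicate (m i) (i.1 + 1)

variable {k : ℕ} (m : Fin k → ℕ)

lemma zero_notMem_ofSuccCounts : 0 ∉ ofSuccCounts m := by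
  simp [ofSuccCounts, mem_sum, mem_replicate]

lemma count_ofSuccCounts (i : Fin k) : (ofSuccCounts m).count (i.1 + 1) = m i := by
  simp [ofSuccCounts, count_sum', count_replicate, Fin.val_inj]

lemma toFinset_subset_image_succ {s : Multiset ℕ} (h0 : 0 ∉ s) (hk : ∀ a ∈ s, a ≤ k) :
    s.toFinset ⊆ univ.image fun i : Fin k ↦ i.1 + 1 := by
  intro a ha
  rw [mem_toFinset] at ha
  have h1 : a ≠ 0 := fun h ↦ h0 (h ▸ ha)
  have h2 := hk a ha
  exact Finset.mem_image.2 ⟨⟨a - 1, by omega⟩, Finset.mem_univ _, by simp; omega⟩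

lemma ofSuccCounts_count {s : Multiset ℕ} (h0 : 0 ∉ s) (hk : ∀ a ∈ s, a ≤ k) :
    ofSuccCounts (fun i : Fin k ↦ s.count (i.1 + 1)) = s := by
  rw [ofSuccCounts, ← Finset.sum_image (s := univ) (g := fun i : Fin k ↦ i.1 + 1)
      (f := fun a ↦ replicate (s.count a) a) fun i _ j _ h ↦ Fin.ext (Nat.succ_injective h),
    ← Finset.sum_subset (toFinset_subset_image_succ h0 hk)]
  · simp_rw [← nsmul_singleton]
    exact toFinset_sum_count_nsmul_eq s
  · intro a _ ha
    rw [count_eq_zero_of_notMem (by simpa using ha), replicate_zero]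

lemma sum_ofSuccCounts : (ofSuccCounts m).sum = ∑ i, (i.1 + 1) * m i := by
  simp [ofSuccCounts, sum_sum, mul_comm]

lemma card_ofSuccCounts : card (ofSuccCounts m) = ∑ i, m i := by
  simp [ofSuccCounts]

lemma prod_map_ofSuccCounts {M : Type*} [CommMonoid M] (F : ℕ → M) :
    ((ofSuccCounts m).map F).prod = ∏ i, F (i.1 + 1) ^ m i := by
  rw [ofSuccCounts, ← coe_mapAddMonoidHom, map_sum, prod_sum]
  simp

lemma mem_ofSuccCounts_le {a : ℕ} (ha : a ∈ ofSuccCounts m) : a ≤ k := by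
  obtain ⟨i, -, hi⟩ := mem_sum.1 ha
  rw [eq_of_mem_replicate hi]
  exact i.2

lemma partitionSymmetry_ofSuccCounts :
    (ofSuccCounts m).partitionSymmetry =
      ∏ i, (m i).factorial * (i.1 + 1).factorial ^ m i := by
  rw [partitionSymmetry, prod_map_ofSuccCounts, prod_factorial_count_eq
      (toFinset_subset_image_succ (zero_notMem_ofSuccCounts m) fun _ ↦ mem_ofSuccCounts_le m),
    Finset.prod_image fun i _ j _ h ↦ Fin.ext (Nat.succ_injective h),
    Finset.prod_mul_distrib, mul_comm]
  simp [count_ofSuccCounts]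

end Multiset

/-- Faà di Bruno's formula: for `k`-times continuously differentiable `f, g : ℝ → ℝ`,
the `k`-th derivative of `f ∘ g` is a sum over tuples `m = (m_1, …, m_k)` of nonnegative
integers with `∑ j, j * m_j = k` (here `m i` encodes `m_{i+1}`), with coefficients
`c_k(m) = k! / ∏ j (m_j! (j!)^{m_j})`. -/
theorem faa_di_bruno (k : ℕ) (hk : 1 ≤ k) (f g : ℝ → ℝ)
    (hf : ContDiff ℝ k f) (hg : ContDiff ℝ k g) (x : ℝ) :
    iteratedDeriv k (f ∘ g) x =
      ∑ m ∈ (Fintype.piFinset fun _ : Fin k => Finset.range (k + 1)).filter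
          (fun m : Fin k → ℕ => ∑ j : Fin k, (j.1 + 1) * m j = k),
        ((k.factorial : ℝ) /
            ∏ j : Fin k, ((m j).factorial * ((j.1 + 1).factorial) ^ (m j) : ℕ)) *
          iteratedDeriv (∑ j : Fin k, m j) f (g x) *
          ∏ i : Fin k, (iteratedDeriv (i.1 + 1) g x) ^ (m i) := by
  have hcounts (c : OrderedFinpartition k) :
      Multiset.ofSuccCounts (fun i : Fin k ↦ c.partSizes.count (i.1 + 1)) = c.partSizes :=
    Multiset.ofSuccCounts_count c.zero_notMem_partSizes fun a ha ↦
      (Multiset.le_sum_of_mem ha).trans_eq c.sum_partSizes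
  rw [iteratedDeriv_comp_eq_sum_orderedFinpartition hf.contDiffAt hg.contDiffAt le_rfl,
    ← Finset.sum_fiberwise_of_maps_to (s := univ)
      (g := fun (c : OrderedFinpartition k) (i : Fin k) ↦ c.partSizes.count (i.1 + 1))
      fun c _ ↦ ?_]
  · refine Finset.sum_congr rfl fun m hm ↦ ?_
    have hiff (c : OrderedFinpartition k) :
        (fun i : Fin k ↦ c.partSizes.count (i.1 + 1)) = m ↔
          c.partSizes = Multiset.ofSuccCounts m := by
      refine ⟨fun h ↦ by rw [← h, hcounts], fun h ↦ ?_⟩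
      funext i
      rw [h, Multiset.count_ofSuccCounts]
    have hterm (c : OrderedFinpartition k) (hc : c.partSizes = Multiset.ofSuccCounts m) :
        iteratedDeriv c.length f (g x) * ∏ i, iteratedDeriv (c.partSize i) g x =
          iteratedDeriv (∑ j, m j) f (g x) * ∏ i : Fin k, iteratedDeriv (i.1 + 1) g x ^ m i := by
      rw [← Multiset.card_ofSuccCounts, ← Multiset.prod_map_ofSuccCounts m fun a ↦
        iteratedDeriv a g x, ← hc]
      simp [OrderedFinpartition.partSizes, Finset.prod, Function.comp_def]
    have hcount := OrderedFinpartition.numPartSizes_mul_partitionSymmetry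
      _ (Multiset.zero_notMem_ofSuccCounts m)
      ((Multiset.sum_ofSuccCounts m).trans (Finset.mem_filter.1 hm).2)
    rw [Multiset.partitionSymmetry_ofSuccCounts] at hcount
    simp only [hiff]
    rw [Finset.sum_congr rfl fun c hc ↦ hterm c (Finset.mem_filter.1 hc).2, Finset.sum_const,
      nsmul_eq_mul, mul_assoc, ← hcount, OrderedFinpartition.numPartSizes]
    congr 1
    rw [eq_div_iff (by positivity)]
    push_cast
    rfl
  · rw [Finset.mem_filter, Fintype.mem_piFinset, ← Multiset.sum_ofSuccCounts, hcounts]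
    refine ⟨fun i ↦ Finset.mem_range_succ_iff.2 ?_, c.sum_partSizes⟩
    refine (Multiset.count_le_card _ _).trans ?_
    simpa [OrderedFinpartition.partSizes] using c.length_le
end

section
/- The Faà di Bruno coefficients satisfy the paper's recursion: define c_1(1) = 1 and, for k ≥ 2 and m = (m_1,…,m_k) a tuple of nonnegative integers with Σ_{j=1}^{k} j·m_j = k, c_k(m) = c_{k-1}(m_1−1, m_2, …, m_{k-1})·1_{{m_1>0}} + Σ_{j=1}^{k-1} (m_j+1)·c_{k-1}(m_1,…,m_{j-1}, m_j+1, m_{j+1}−1, m_{j+2},…,m_{k-1})·1_{{m_{j+1}>0}}. Then for every k ≥ 1 and every m = (m_1,…,m_k) with Σ_{j=1}^{k} j·m_j = k, one has c_k(m) = k! / ∏_{j=1}^{k} ( m_j! · (j!)^{m_j} ). -/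
open Finset

/-- Changing one entry of a tuple changes a product over the entries by the ratio of the
corresponding factors. -/
@[to_additive]
theorem Finset.prod_update_mul {ι α M : Type*} [DecidableEq ι] [CommMonoid M] {s : Finset ι}
    {a : ι} (ha : a ∈ s) (f : ι → α → M) (m : ι → α) (v : α) :
    (∏ j ∈ s, f j (Function.update m a v j)) * f a (m a) = (∏ j ∈ s, f j (m j)) * f a v := by
  rw [← mul_prod_erase s _ ha, ← mul_prod_erase s (fun j => f j (m j)) ha,
    prod_congr rfl (g := fun j => f j (m j))
      (fun j hj => by rw [Function.update_of_ne (ne_of_mem_erase hj)])]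
  simp only [Function.update_self]
  rw [mul_right_comm, mul_comm (f a v), mul_right_comm]

theorem sum_Icc_one_succ_bot {M : Type*} [AddCommMonoid M] (f : ℕ → M) (n : ℕ) :
    ∑ j ∈ Icc 1 (n + 1), f j = f 1 + ∑ j ∈ Icc 1 n, f (j + 1) := by
  induction n with
  | zero => simp
  | succ n ih =>
    rw [sum_Icc_succ_top (by omega), ih, sum_Icc_succ_top (b := n) (by omega), add_assoc]

/-- The factor contributed by `n` blocks of size `j` to the denominator of a Faà di Bruno
coefficient. -/
def faaDiBrunoFactor (j n : ℕ) : ℕ := n.factorial * j.factorial ^ n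

theorem faaDiBrunoFactor_zero (j : ℕ) : faaDiBrunoFactor j 0 = 1 := by
  simp [faaDiBrunoFactor]

theorem faaDiBrunoFactor_succ (j n : ℕ) :
    faaDiBrunoFactor j (n + 1) = faaDiBrunoFactor j n * ((n + 1) * j.factorial) := by
  simp only [faaDiBrunoFactor, Nat.factorial_succ, pow_succ]
  ring

theorem faaDiBrunoFactor_pos (j n : ℕ) : 0 < faaDiBrunoFactor j n :=
  Nat.mul_pos n.factorial_pos (pow_pos j.factorial_pos n)

/-- The denominator of the Faà di Bruno coefficient of the tuple `(m 1, …, m k)`. -/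
def faaDiBrunoDenom (k : ℕ) (m : ℕ → ℕ) : ℕ := ∏ j ∈ Icc 1 k, faaDiBrunoFactor j (m j)

theorem faaDiBrunoDenom_pos (k : ℕ) (m : ℕ → ℕ) : 0 < faaDiBrunoDenom k m :=
  prod_pos fun j _ => faaDiBrunoFactor_pos j (m j)

theorem last_eq_zero_of_weight_eq {n : ℕ} {m : ℕ → ℕ}
    (h : ∑ j ∈ Icc 1 (n + 1), j * m j = n) : m (n + 1) = 0 := by
  rw [sum_Icc_succ_top (by omega)] at h
  by_contra h0
  have := Nat.le_mul_of_pos_right (n + 1) (Nat.pos_of_ne_zero h0)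
  omega

theorem weight_truncate {n : ℕ} {m : ℕ → ℕ}
    (h : ∑ j ∈ Icc 1 (n + 1), j * m j = n) : ∑ j ∈ Icc 1 n, j * m j = n := by
  have h0 := last_eq_zero_of_weight_eq h
  rwa [sum_Icc_succ_top (by omega), h0, mul_zero, add_zero] at h

theorem faaDiBrunoDenom_truncate {n : ℕ} {m : ℕ → ℕ}
    (h : ∑ j ∈ Icc 1 (n + 1), j * m j = n) :
    faaDiBrunoDenom n m = faaDiBrunoDenom (n + 1) m := by
  rw [faaDiBrunoDenom, faaDiBrunoDenom, prod_Icc_succ_top (by omega),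
    last_eq_zero_of_weight_eq h, faaDiBrunoFactor_zero, mul_one]

theorem weight_remove_singleton {n : ℕ} {m : ℕ → ℕ}
    (h : ∑ j ∈ Icc 1 (n + 1), j * m j = n + 1) (h1 : 0 < m 1) :
    ∑ j ∈ Icc 1 (n + 1), j * Function.update m 1 (m 1 - 1) j = n := by
  have := sum_update_add (s := Icc 1 (n + 1)) (a := 1) (by simp) (fun j v => j * v) m (m 1 - 1)
  simp only [h] at this
  omega

theorem faaDiBrunoDenom_remove_singleton {k : ℕ} (hk : 1 ≤ k) {m : ℕ → ℕ} (h1 : 0 < m 1) :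
    faaDiBrunoDenom k (Function.update m 1 (m 1 - 1)) * m 1 = faaDiBrunoDenom k m := by
  have := prod_update_mul (s := Icc 1 k) (a := 1) (by simpa using hk) faaDiBrunoFactor m (m 1 - 1)
  obtain ⟨v, hv⟩ := Nat.exists_eq_succ_of_ne_zero h1.ne'
  simp only [hv, Nat.succ_eq_add_one, Nat.add_sub_cancel] at this ⊢
  rw [faaDiBrunoFactor_succ] at this
  apply Nat.eq_of_mul_eq_mul_right (faaDiBrunoFactor_pos 1 v)
  simp only [faaDiBrunoDenom]
  rw [← this, Nat.factorial_one]
  ring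

theorem weight_shrink_block {n j : ℕ} {m : ℕ → ℕ} (hj : j ∈ Icc 1 n)
    (h : ∑ i ∈ Icc 1 (n + 1), i * m i = n + 1) (hm : 0 < m (j + 1)) :
    ∑ i ∈ Icc 1 (n + 1),
      i * Function.update (Function.update m j (m j + 1)) (j + 1) (m (j + 1) - 1) i = n := by
  rw [mem_Icc] at hj
  have e1 := sum_update_add (s := Icc 1 (n + 1)) (a := j) (by rw [mem_Icc]; omega)
    (fun i v => i * v) m (m j + 1)
  have e2 := sum_update_add (s := Icc 1 (n + 1)) (a := j + 1) (by rw [mem_Icc]; omega)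
    (fun i v => i * v) (Function.update m j (m j + 1)) (m (j + 1) - 1)
  rw [Function.update_of_ne (by omega)] at e2
  obtain ⟨v, hv⟩ := Nat.exists_eq_succ_of_ne_zero hm.ne'
  simp only [hv, Nat.succ_eq_add_one, Nat.add_sub_cancel, h, mul_add, add_mul] at e1 e2 ⊢
  omega

theorem faaDiBrunoDenom_shrink_block {n j : ℕ} {m : ℕ → ℕ} (hj : j ∈ Icc 1 n)
    (hm : 0 < m (j + 1)) :
    faaDiBrunoDenom (n + 1)
        (Function.update (Function.update m j (m j + 1)) (j + 1) (m (j + 1) - 1)) *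
        ((j + 1) * m (j + 1)) =
      faaDiBrunoDenom (n + 1) m * (m j + 1) := by
  rw [mem_Icc] at hj
  have e1 := prod_update_mul (s := Icc 1 (n + 1)) (a := j) (by rw [mem_Icc]; omega)
    faaDiBrunoFactor m (m j + 1)
  have e2 := prod_update_mul (s := Icc 1 (n + 1)) (a := j + 1) (by rw [mem_Icc]; omega)
    faaDiBrunoFactor (Function.update m j (m j + 1)) (m (j + 1) - 1)
  rw [Function.update_of_ne (by omega)] at e2
  obtain ⟨v, hv⟩ := Nat.exists_eq_succ_of_ne_zero hm.ne'
  simp only [hv, Nat.succ_eq_add_one, Nat.add_sub_cancel, faaDiBrunoFactor_succ,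
    Nat.factorial_succ] at e1 e2 ⊢
  simp only [← faaDiBrunoDenom.eq_1] at e1 e2
  have e1' : faaDiBrunoDenom (n + 1) (Function.update m j (m j + 1)) =
      faaDiBrunoDenom (n + 1) m * ((m j + 1) * j.factorial) := by
    apply Nat.eq_of_mul_eq_mul_right (faaDiBrunoFactor_pos j (m j))
    rw [e1]
    ring
  rw [e1'] at e2
  apply Nat.eq_of_mul_eq_mul_right
    (Nat.mul_pos (faaDiBrunoFactor_pos (j + 1) v) j.factorial_pos)
  linear_combination e2

/-- The Faà di Bruno coefficients satisfy the paper's recursion: a tuple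
`(m_1, …, m_k)` is encoded as a function `m : ℕ → ℕ` (only the indices `1, …, k`
are relevant).  If a family `c` satisfies `c 1 (1) = 1` together with the recursion
`c_k(m) = c_{k-1}(m_1 - 1, m_2, …, m_{k-1}) 1_{{m_1 > 0}}
  + ∑_{j=1}^{k-1} (m_j + 1) c_{k-1}(m_1, …, m_j + 1, m_{j+1} - 1, …, m_{k-1}) 1_{{m_{j+1} > 0}}`
for all `k ≥ 2` and tuples with `∑_{j=1}^{k} j m_j = k`, then
`c k m = k! / ∏_{j=1}^{k} (m_j! (j!)^{m_j})` on all such tuples. -/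
theorem faa_di_bruno_coeff_recursion
    (c : ℕ → (ℕ → ℕ) → ℝ)
    (hbase : ∀ m : ℕ → ℕ, m 1 = 1 → c 1 m = 1)
    (hrec : ∀ k : ℕ, 2 ≤ k → ∀ m : ℕ → ℕ, (∑ j ∈ Icc 1 k, j * m j = k) →
      c k m =
        (if 0 < m 1 then c (k - 1) (Function.update m 1 (m 1 - 1)) else 0) +
          ∑ j ∈ Icc 1 (k - 1),
            (if 0 < m (j + 1) then
              ((m j : ℝ) + 1) *
                c (k - 1)
                  (Function.update (Function.update m j (m j + 1)) (j + 1) (m (j + 1) - 1))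
            else 0)) :
    ∀ k : ℕ, 1 ≤ k → ∀ m : ℕ → ℕ, (∑ j ∈ Icc 1 k, j * m j = k) →
      c k m = (k.factorial : ℝ) /
        ∏ j ∈ Icc 1 k, ((m j).factorial * (j.factorial) ^ (m j) : ℕ) := by
  suffices h : ∀ k : ℕ, 1 ≤ k → ∀ m : ℕ → ℕ, (∑ j ∈ Icc 1 k, j * m j = k) →
      c k m = (k.factorial : ℝ) / faaDiBrunoDenom k m from h
  intro k hk
  induction k, hk using Nat.le_induction with
  | base =>
    intro m hm
    have h1 : m 1 = 1 := by simpa using hm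
    simp [hbase m h1, h1, faaDiBrunoDenom, faaDiBrunoFactor]
  | succ n hn ih =>
    intro m hm
    have hpos (m' : ℕ → ℕ) : (faaDiBrunoDenom (n + 1) m' : ℝ) ≠ 0 := by
      exact_mod_cast (faaDiBrunoDenom_pos (n + 1) m').ne'
    have hfirst : (if 0 < m 1 then c n (Function.update m 1 (m 1 - 1)) else 0) =
        (n.factorial : ℝ) / faaDiBrunoDenom (n + 1) m * m 1 := by
      split_ifs with h1
      · have hw := weight_remove_singleton hm h1
        rw [ih _ (weight_truncate hw), faaDiBrunoDenom_truncate hw,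
          ← faaDiBrunoDenom_remove_singleton (k := n + 1) (by omega) h1]
        have := hpos (Function.update m 1 (m 1 - 1))
        have : (m 1 : ℝ) ≠ 0 := by exact_mod_cast h1.ne'
        push_cast
        field_simp
      · simp [Nat.eq_zero_of_not_pos h1]
    have hterm : ∀ j ∈ Icc 1 n, (if 0 < m (j + 1) then ((m j : ℝ) + 1) *
        c n (Function.update (Function.update m j (m j + 1)) (j + 1) (m (j + 1) - 1)) else 0) =
        (n.factorial : ℝ) / faaDiBrunoDenom (n + 1) m * ((j + 1) * m (j + 1) : ℕ) := by
      intro j hj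
      split_ifs with h1
      · have hw := weight_shrink_block hj hm h1
        have hd := faaDiBrunoDenom_shrink_block hj h1
        rw [ih _ (weight_truncate hw), faaDiBrunoDenom_truncate hw, mul_div_assoc',
          div_mul_eq_mul_div, div_eq_div_iff (hpos _) (hpos _)]
        rify at hd
        push_cast
        linear_combination -(n.factorial : ℝ) * hd
      · simp [Nat.eq_zero_of_not_pos h1]
    have hsum : m 1 + ∑ j ∈ Icc 1 n, (j + 1) * m (j + 1) = n + 1 := by
      rw [← hm, sum_Icc_one_succ_bot, one_mul]
    rw [hrec (n + 1) (by omega) m hm, Nat.add_sub_cancel, hfirst, sum_congr rfl hterm, ← mul_sum,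
      ← mul_add, ← Nat.cast_sum, ← Nat.cast_add, hsum, Nat.factorial_succ]
    push_cast
    ring
end
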